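/- Let φ : ℝⁿ → ℝ be C² and strictly convex with positive-definite Hessian, with φ(x)/‖x‖ → ∞ at infinity and ∫ e^{-φ} dx = 1. Then for all smooth enough g, Var_{μ_φ}(g) ≤ ∫ ∇g · Hess(φ)^{-1} ∇g dμ_φ, where μ_φ(dx) = e^{-φ(x)}dx and Var_μ(g) = ∫ (g − ∫ g dμ)² dμ. -/

import Mathlib

open MeasureTheory Real Filter Bornology
open scoped RealInnerProductSpace

/-- The variance of `g` with respect to `μ`. -/
noncomputable def Var {n : ℕ} (μ : Measure (EuclideanSpace ℝ (Fin n)))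
    (g : EuclideanSpace ℝ (Fin n) → ℝ) : ℝ :=
  ∫ x, (g x - ∫ y, g y ∂μ) ^ 2 ∂μ


open scoped ENNReal Topology Pointwise

section PrekopaLeindler

/-- One-dimensional Brunn–Minkowski inequality for nonempty compact sets. -/
theorem volume_add_volume_le_volume_add_of_isCompact {K L : Set ℝ} (hK : IsCompact K)
    (hL : IsCompact L) (hK₀ : K.Nonempty) (hL₀ : L.Nonempty) :
    volume K + volume L ≤ volume (Set.image2 (· + ·) K L) := by
  obtain ⟨a, haK, ha⟩ := hK.exists_isGreatest hK₀
  obtain ⟨b, hbL, hb⟩ := hL.exists_isLeast hL₀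
  have hK' : volume ((· + b) '' K) = volume K := measure_preimage_add_right volume (-b) K ▸ by
    rw [Set.image_add_right]
  have hL' : volume ((a + ·) '' L) = volume L := measure_preimage_add volume (-a) L ▸ by
    rw [Set.image_add_left]
  rw [← hK', ← hL', ← measure_union₀]
  · refine measure_mono (Set.union_subset ?_ ?_)
    · rintro _ ⟨x, hx, rfl⟩
      exact ⟨x, hx, b, hbL, rfl⟩
    · rintro _ ⟨y, hy, rfl⟩
      exact ⟨a, haK, y, hy, rfl⟩
  · exact (hL.image (by fun_prop)).measurableSet.nullMeasurableSet
  · refine measure_mono_null (t := {a + b}) ?_ (by simp)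
    rintro _ ⟨⟨x, hx, rfl⟩, y, hy, hxy⟩
    have h₁ := ha hx
    have h₂ := hb hy
    simp only [Set.mem_singleton_iff] at *
    linarith

/-- One-dimensional Brunn–Minkowski inequality, in midpoint form. -/
theorem volume_add_volume_le_two_mul_volume {A B C : Set ℝ} (hA : MeasurableSet A)
    (hB : MeasurableSet B) (hA₀ : A.Nonempty) (hB₀ : B.Nonempty)
    (h : ∀ x ∈ A, ∀ y ∈ B, midpoint ℝ x y ∈ C) :
    volume A + volume B ≤ 2 * volume C := by
  have key : ∀ K ⊆ A, ∀ L ⊆ B, IsCompact K → IsCompact L → K.Nonempty → L.Nonempty →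
      volume K + volume L ≤ 2 * volume C := by
    intro K hKA L hLB hK hL hK₀ hL₀
    refine (volume_add_volume_le_volume_add_of_isCompact hK hL hK₀ hL₀).trans ?_
    have h₁ : volume ((2 : ℝ) • C) = 2 * volume C := by
      rw [Measure.addHaar_smul]
      simp
    rw [← h₁]
    refine measure_mono ?_
    rintro _ ⟨x, hx, y, hy, rfl⟩
    refine ⟨_, h x (hKA hx) y (hLB hy), ?_⟩
    simp [midpoint_eq_smul_add]
  obtain ⟨a, ha⟩ := hA₀
  obtain ⟨b, hb⟩ := hB₀
  rw [hA.measure_eq_iSup_isCompact, hB.measure_eq_iSup_isCompact]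
  simp only [iSup_and', iSup_subtype']
  have : ∀ S : Set ℝ, Nonempty {K : Set ℝ // K ⊆ S ∧ IsCompact K} := fun S =>
    ⟨⟨∅, Set.empty_subset S, isCompact_empty⟩⟩
  refine ENNReal.iSup_add_iSup_le ?_
  rintro ⟨K, hKA, hK⟩ ⟨L, hLB, hL⟩
  refine le_trans (add_le_add (measure_mono (Set.subset_insert a K))
    (measure_mono (Set.subset_insert b L))) ?_
  exact key _ (Set.insert_subset ha hKA) _ (Set.insert_subset hb hLB) (hK.insert a) (hL.insert b)
    (Set.insert_nonempty _ _) (Set.insert_nonempty _ _)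

theorem lintegral_add_lintegral_le_two_mul_lintegral {f g h : ℝ → ℝ} (hf : Measurable f)
    (hg : Measurable g) (hh : Measurable h) (hf₀ : ∀ x, 0 ≤ f x) (hg₀ : ∀ x, 0 ≤ g x)
    (hh₀ : ∀ x, 0 ≤ h x) (hf₁ : IsLUB (Set.range f) 1) (hg₁ : IsLUB (Set.range g) 1)
    (H : ∀ x y, f x * g y ≤ h (midpoint ℝ x y) ^ 2) :
    (∫⁻ x, ENNReal.ofReal (f x)) + ∫⁻ x, ENNReal.ofReal (g x) ≤
      2 * ∫⁻ x, ENNReal.ofReal (h x) := by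
  rw [lintegral_eq_lintegral_meas_lt _ (ae_of_all _ hf₀) hf.aemeasurable,
    lintegral_eq_lintegral_meas_lt _ (ae_of_all _ hg₀) hg.aemeasurable,
    lintegral_eq_lintegral_meas_lt _ (ae_of_all _ hh₀) hh.aemeasurable,
    ← lintegral_const_mul' _ _ (by simp), ← lintegral_add_left]
  · refine setLIntegral_mono' measurableSet_Ioi fun t (ht : 0 < t) => ?_
    rcases lt_or_ge t 1 with ht₁ | ht₁
    · refine volume_add_volume_le_two_mul_volume (measurableSet_lt measurable_const hf)
        (measurableSet_lt measurable_const hg) ?_ ?_ ?_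
      · obtain ⟨_, ⟨x, rfl⟩, hx⟩ := (lt_isLUB_iff hf₁).1 ht₁
        exact ⟨x, hx⟩
      · obtain ⟨_, ⟨x, rfl⟩, hx⟩ := (lt_isLUB_iff hg₁).1 ht₁
        exact ⟨x, hx⟩
      · intro x (hx : t < f x) y (hy : t < g y)
        refine lt_of_pow_lt_pow_left₀ 2 (hh₀ _) (lt_of_lt_of_le ?_ (H x y))
        nlinarith
    · have h₁ : {a | t < f a} = ∅ := Set.eq_empty_of_forall_notMem fun x (hx : t < f x) =>
        absurd (hf₁.1 ⟨x, rfl⟩) (by linarith)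
      have h₂ : {a | t < g a} = ∅ := Set.eq_empty_of_forall_notMem fun x (hx : t < g x) =>
        absurd (hg₁.1 ⟨x, rfl⟩) (by linarith)
      simp [h₁, h₂]
  · exact (Antitone.measurable fun s t hst =>
      measure_mono fun x (hx : t < f x) => lt_of_le_of_lt hst hx)

theorem ENNReal.mul_le_sq_of_add_le_two_mul {x y z : ℝ≥0∞} (h : x + y ≤ 2 * z) :
    x * y ≤ z ^ 2 := by
  rcases eq_or_ne z ∞ with rfl | hz
  · simp
  have hxy : x + y ≠ ∞ := (h.trans_lt (ENNReal.mul_lt_top (by simp) hz.lt_top)).ne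
  lift z to NNReal using hz
  lift x to NNReal using (ENNReal.add_ne_top.1 hxy).1
  lift y to NNReal using (ENNReal.add_ne_top.1 hxy).2
  norm_cast at h ⊢
  have h' : (x : ℝ) + y ≤ 2 * z := by exact_mod_cast h
  have : (x : ℝ) * y ≤ z ^ 2 := by
    nlinarith [sq_nonneg ((x : ℝ) - y), x.coe_nonneg, y.coe_nonneg, z.coe_nonneg]
  exact_mod_cast this

/-- Midpoint case of the Prékopa–Leindler inequality on the line, for bounded functions. -/
theorem lintegral_mul_lintegral_le_sq_of_bddAbove {f g h : ℝ → ℝ} (hf : Measurable f)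
    (hg : Measurable g) (hh : Measurable h) (hf₀ : ∀ x, 0 ≤ f x) (hg₀ : ∀ x, 0 ≤ g x)
    (hh₀ : ∀ x, 0 ≤ h x) (hf₁ : BddAbove (Set.range f)) (hg₁ : BddAbove (Set.range g))
    (H : ∀ x y, f x * g y ≤ h (midpoint ℝ x y) ^ 2) :
    (∫⁻ x, ENNReal.ofReal (f x)) * ∫⁻ x, ENNReal.ofReal (g x) ≤
      (∫⁻ x, ENNReal.ofReal (h x)) ^ 2 := by
  have scale : ∀ {u : ℝ → ℝ} {c : ℝ}, Measurable u → 0 < c →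
      ∫⁻ x, ENNReal.ofReal (u x) = ENNReal.ofReal c * ∫⁻ x, ENNReal.ofReal (u x / c) := by
    intro u c hu hc
    rw [← lintegral_const_mul _ (by fun_prop)]
    refine lintegral_congr fun x => ?_
    rw [← ENNReal.ofReal_mul hc.le]
    congr 1
    field_simp
  have lub : ∀ {u : ℝ → ℝ} {c : ℝ}, IsLUB (Set.range u) c → 0 < c →
      IsLUB (Set.range fun x => u x / c) 1 := by
    intro u c hu hc
    refine ⟨?_, fun b hb => ?_⟩
    · rintro _ ⟨x, rfl⟩
      exact (div_le_one hc).2 (hu.1 ⟨x, rfl⟩)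
    · have : c ≤ b * c := hu.2 (by
        rintro _ ⟨x, rfl⟩
        exact (div_le_iff₀ hc).1 (hb ⟨x, rfl⟩))
      nlinarith
  have hfa := isLUB_csSup (Set.range_nonempty f) hf₁
  have hgb := isLUB_csSup (Set.range_nonempty g) hg₁
  set a := sSup (Set.range f)
  set b := sSup (Set.range g)
  have ha₀ : 0 ≤ a := (hf₀ 0).trans (hfa.1 ⟨0, rfl⟩)
  have hb₀ : 0 ≤ b := (hg₀ 0).trans (hgb.1 ⟨0, rfl⟩)
  rcases ha₀.eq_or_lt with ha | ha
  · have : ∀ x, f x = 0 := fun x => le_antisymm (ha ▸ hfa.1 ⟨x, rfl⟩) (hf₀ x)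
    simp [this]
  rcases hb₀.eq_or_lt with hb | hb
  · have : ∀ x, g x = 0 := fun x => le_antisymm (hb ▸ hgb.1 ⟨x, rfl⟩) (hg₀ x)
    simp [this]
  have hc : 0 < √(a * b) := Real.sqrt_pos.2 (mul_pos ha hb)
  rw [scale hf ha, scale hg hb, scale hh hc, mul_pow, mul_mul_mul_comm, ← ENNReal.ofReal_mul ha.le,
    ← ENNReal.ofReal_pow hc.le, Real.sq_sqrt (mul_pos ha hb).le]
  refine mul_le_mul_right (ENNReal.mul_le_sq_of_add_le_two_mul ?_) _
  refine lintegral_add_lintegral_le_two_mul_lintegral (by fun_prop) (by fun_prop) (by fun_prop)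
    (fun x => div_nonneg (hf₀ x) ha.le) (fun x => div_nonneg (hg₀ x) hb.le)
    (fun x => div_nonneg (hh₀ x) hc.le) (lub hfa ha) (lub hgb hb) fun x y => ?_
  rw [div_pow, Real.sq_sqrt (mul_pos ha hb).le, div_mul_div_comm]
  exact div_le_div_of_nonneg_right (H x y) (mul_pos ha hb).le

/-- A measure satisfies the midpoint case of the Prékopa–Leindler inequality. -/
def PrekopaLeindler {E : Type*} [AddCommGroup E] [Module ℝ E] [MeasurableSpace E]
    (μ : Measure E) : Prop :=
  ∀ f g h : E → ℝ≥0∞, Measurable f → Measurable g → Measurable h →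
    (∀ x y, f x * g y ≤ h (midpoint ℝ x y) ^ 2) →
    (∫⁻ x, f x ∂μ) * ∫⁻ x, g x ∂μ ≤ (∫⁻ x, h x ∂μ) ^ 2

theorem prekopaLeindler_real : PrekopaLeindler (volume : Measure ℝ) := by
  intro f g h hf hg hh H
  have lim : ∀ {u : ℝ → ℝ≥0∞}, Measurable u →
      Tendsto (fun N : ℕ => ∫⁻ x, min (u x) N) atTop (𝓝 (∫⁻ x, u x)) := by
    intro u hu
    refine lintegral_tendsto_of_tendsto_of_monotone (fun N => by fun_prop)
      (ae_of_all _ fun x N M hNM => min_le_min_left _ (by exact_mod_cast hNM))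
      (ae_of_all _ fun x => ?_)
    simpa using (tendsto_const_nhds (x := u x)).min ENNReal.tendsto_nat_nhds_top
  have fin : ∀ (u : ℝ → ℝ≥0∞) (N : ℕ) (x : ℝ), min (u x) N ≠ ∞ := fun u N x =>
    ((min_le_right _ _).trans_lt (ENNReal.natCast_lt_top N)).ne
  have conv : ∀ (u : ℝ → ℝ≥0∞) (N : ℕ),
      ∫⁻ x, ENNReal.ofReal (min (u x) N).toReal = ∫⁻ x, min (u x) N := fun u N =>
    lintegral_congr fun x => ENNReal.ofReal_toReal (fin u N x)
  have bdd : ∀ (u : ℝ → ℝ≥0∞) (N : ℕ),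
      BddAbove (Set.range fun x => (min (u x) N).toReal) := by
    refine fun u N => ⟨N, ?_⟩
    rintro _ ⟨x, rfl⟩
    simpa using ENNReal.toReal_mono (by simp) (min_le_right (u x) (N : ℝ≥0∞))
  rw [pow_two]
  have hsq : ∀ N : ℕ, (∫⁻ x, min (f x) N) * ∫⁻ x, min (g x) N ≤ (∫⁻ x, h x) * ∫⁻ x, h x := by
    intro N
    rw [← pow_two]
    refine le_trans ?_ (pow_le_pow_left₀ zero_le (lintegral_mono fun x => min_le_left (h x) N) 2)
    rw [← conv f, ← conv g, ← conv h]
    refine lintegral_mul_lintegral_le_sq_of_bddAbove (by fun_prop) (by fun_prop) (by fun_prop)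
      (fun _ => ENNReal.toReal_nonneg) (fun _ => ENNReal.toReal_nonneg)
      (fun _ => ENNReal.toReal_nonneg) (bdd f N) (bdd g N) fun x y => ?_
    rw [← ENNReal.toReal_mul, ← ENNReal.toReal_pow]
    refine ENNReal.toReal_mono (ENNReal.pow_ne_top (fin h N _)) ?_
    rcases min_choice (h (midpoint ℝ x y)) (N : ℝ≥0∞) with hm | hm <;> rw [hm]
    · exact (mul_le_mul' (min_le_left _ _) (min_le_left _ _)).trans (H x y)
    · rw [pow_two]
      exact mul_le_mul' (min_le_right _ _) (min_le_right _ _)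
  rcases eq_or_ne (∫⁻ x, f x) 0 with hf₀ | hf₀
  · simp [hf₀]
  rcases eq_or_ne (∫⁻ x, g x) 0 with hg₀ | hg₀
  · simp [hg₀]
  exact le_of_tendsto' (ENNReal.Tendsto.mul (lim hf) (Or.inl hf₀) (lim hg) (Or.inl hg₀)) hsq

theorem PrekopaLeindler.prod {E F : Type*} [AddCommGroup E] [Module ℝ E] [MeasurableSpace E]
    [AddCommGroup F] [Module ℝ F] [MeasurableSpace F] {μ : Measure E} {ν : Measure F}
    [SFinite ν] (hμ : PrekopaLeindler μ) (hν : PrekopaLeindler ν) :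
    PrekopaLeindler (μ.prod ν) := by
  intro f g h hf hg hh H
  rw [lintegral_prod _ hf.aemeasurable, lintegral_prod _ hg.aemeasurable,
    lintegral_prod _ hh.aemeasurable]
  refine hμ _ _ _ hf.lintegral_prod_right' hg.lintegral_prod_right' hh.lintegral_prod_right'
    fun x x' => ?_
  refine hν _ _ _ (by fun_prop) (by fun_prop) (by fun_prop) fun y y' => ?_
  convert H (x, y) (x', y') using 3
  ext <;> simp [midpoint_eq_smul_add]

theorem PrekopaLeindler.of_measurePreserving {E F : Type*} [AddCommGroup E] [Module ℝ E]
    [MeasurableSpace E] [AddCommGroup F] [Module ℝ F] [MeasurableSpace F] {μ : Measure E}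
    {ν : Measure F} (hμ : PrekopaLeindler μ) (e : E →ₗ[ℝ] F) (he : MeasurePreserving e μ ν) :
    PrekopaLeindler ν := by
  intro f g h hf hg hh H
  rw [← he.lintegral_comp hf, ← he.lintegral_comp hg, ← he.lintegral_comp hh]
  refine hμ _ _ _ (hf.comp he.measurable) (hg.comp he.measurable) (hh.comp he.measurable)
    fun x y => ?_
  convert H (e x) (e y) using 3
  simp [midpoint_eq_smul_add]

theorem prekopaLeindler_pi (n : ℕ) : PrekopaLeindler (volume : Measure (Fin n → ℝ)) := by
  induction n with
  | zero =>
    intro f g h _ _ _ H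
    rw [Measure.volume_pi_eq_dirac 0]
    simpa using H 0 0
  | succ n ih =>
    refine (prekopaLeindler_real.prod ih).of_measurePreserving
      (Fin.consLinearEquiv ℝ fun _ : Fin (n + 1) => ℝ).toLinearMap ?_
    have he : ⇑(Fin.consLinearEquiv ℝ fun _ : Fin (n + 1) => ℝ).toLinearMap =
        (MeasurableEquiv.piFinSuccAbove (fun _ : Fin (n + 1) => ℝ) 0).symm := by
      ext x
      simp
    rw [he]
    exact (volume_preserving_piFinSuccAbove (fun _ : Fin (n + 1) => ℝ) 0).symm

theorem prekopaLeindler_euclideanSpace (n : ℕ) :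
    PrekopaLeindler (volume : Measure (EuclideanSpace ℝ (Fin n))) :=
  (prekopaLeindler_pi n).of_measurePreserving
    (WithLp.linearEquiv 2 ℝ (Fin n → ℝ)).symm.toLinearMap (PiLp.volume_preserving_toLp (Fin n))

end PrekopaLeindler

section Pointwise

variable {E : Type*} [NormedAddCommGroup E] [InnerProductSpace ℝ E]

/-- Completing the square in a positive semidefinite quadratic form. -/
theorem neg_half_inner_sub_mul_inner_le {A J : E →L[ℝ] E}
    (hsymm : ∀ v w, ⟪A v, w⟫ = ⟪v, A w⟫) (hA : ∀ v, 0 ≤ ⟪v, A v⟫) (hAJ : ∀ p, A (J p) = p)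
    (p v : E) (δ : ℝ) :
    -(⟪v, A v⟫ / 2) - δ * ⟪p, v⟫ ≤ δ ^ 2 / 2 * ⟪p, J p⟫ := by
  have h := hA (v + δ • J p)
  have h₁ : ⟪J p, A v⟫ = ⟪p, v⟫ := by rw [← hsymm, hAJ]
  have h₂ : ⟪v, p⟫ = ⟪p, v⟫ := real_inner_comm _ _
  have h₃ : ⟪J p, p⟫ = ⟪p, J p⟫ := real_inner_comm _ _
  simp only [map_add, map_smul, hAJ, inner_add_left, inner_add_right, real_inner_smul_left,
    real_inner_smul_right, h₁, h₂, h₃] at h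
  linarith

variable [CompleteSpace E] {φ g : E → ℝ} {Hess Hinv : E → E →L[ℝ] E}

theorem ContDiff.gradient {m k : WithTop ℕ∞} (hg : ContDiff ℝ m g) (hk : k + 1 ≤ m) :
    ContDiff ℝ k (gradient g) :=
  (InnerProductSpace.toDual ℝ E).symm.toContinuousLinearEquiv.contDiff.comp
    (hg.fderiv_right hk)

theorem inner_hess_comm (hφ : Differentiable ℝ φ)
    (hHess : ∀ x, HasFDerivAt (gradient φ) (Hess x) x) (x v w : E) :
    ⟪Hess x v, w⟫ = ⟪v, Hess x w⟫ := by
  have h := second_derivative_symmetric (fun y => (hφ y).hasGradientAt.hasFDerivAt)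
    ((InnerProductSpace.toDual ℝ E).toContinuousLinearEquiv.toContinuousLinearMap.hasFDerivAt.comp x
      (hHess x)) v w
  rw [real_inner_comm _ v]
  simpa using h

theorem continuous_hess (hφ : ContDiff ℝ 2 φ)
    (hHess : ∀ x, HasFDerivAt (gradient φ) (Hess x) x) : Continuous Hess := by
  have h : Hess = fderiv ℝ (gradient φ) := funext fun x => (hHess x).fderiv.symm
  rw [h]
  exact (hφ.gradient (k := 1) (by norm_num)).continuous_fderiv (by norm_num)

theorem continuous_hinv (hHess : Continuous Hess)
    (hinv : ∀ x, (Hess x).comp (Hinv x) = ContinuousLinearMap.id ℝ _ ∧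
      (Hinv x).comp (Hess x) = ContinuousLinearMap.id ℝ _) : Continuous Hinv := by
  let u : E → (E →L[ℝ] E)ˣ := fun x => ⟨Hess x, Hinv x, (hinv x).1, (hinv x).2⟩
  have h : Hinv = fun x => Ring.inverse (Hess x) :=
    funext fun x => (Ring.inverse_unit (u x)).symm
  rw [h]
  exact continuous_iff_continuousAt.2 fun x =>
    ContinuousAt.comp (f := Hess) (NormedRing.inverse_continuousAt (u x)) hHess.continuousAt

theorem HasGradientAt.hasDerivAt_comp_add_smul {p z v : E} {s : ℝ}
    (h : HasGradientAt g p (z + s • v)) : HasDerivAt (fun t : ℝ => g (z + t • v)) ⟪p, v⟫ s := by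
  have h₁ : HasDerivAt (fun t : ℝ => z + t • v) v s := by
    simpa using ((hasDerivAt_id s).smul_const v).const_add z
  simpa [Function.comp_def] using h.hasFDerivAt.comp_hasDerivAt s h₁

/-- A lower bound on the Hessian along a segment bounds the second difference from below. -/
theorem le_second_difference (hφ : Differentiable ℝ φ)
    (hHess : ∀ x, HasFDerivAt (gradient φ) (Hess x) x) {z v : E} {c : ℝ}
    (hc : ∀ t ∈ Set.Icc (-1 : ℝ) 1, c ≤ ⟪v, Hess (z + t • v) v⟫) :
    c ≤ φ (z + v) + φ (z - v) - 2 * φ z := by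
  have h₁ : ∀ s : ℝ, HasDerivAt (fun t : ℝ => φ (z + t • v) - c / 2 * t ^ 2)
      (⟪gradient φ (z + s • v), v⟫ - c * s) s := fun s => by
    refine ((hφ _).hasGradientAt.hasDerivAt_comp_add_smul.sub
      ((hasDerivAt_pow 2 s).const_mul (c / 2))).congr_deriv ?_
    simp
    ring
  have h₂ : ∀ s : ℝ, HasDerivAt (fun t : ℝ => ⟪gradient φ (z + t • v), v⟫ - c * t)
      (⟪v, Hess (z + s • v) v⟫ - c) s := fun s => by
    have hl : HasDerivAt (fun t : ℝ => z + t • v) v s := by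
      simpa using ((hasDerivAt_id s).smul_const v).const_add z
    refine ((((hHess (z + s • v)).comp_hasDerivAt s hl).inner ℝ (hasDerivAt_const s v)).sub
      ((hasDerivAt_id s).const_mul c)).congr_deriv ?_
    simp [real_inner_comm]
  have hconv : ConvexOn ℝ (Set.Icc (-1 : ℝ) 1) fun t : ℝ => φ (z + t • v) - c / 2 * t ^ 2 :=
    convexOn_of_hasDerivWithinAt2_nonneg (convex_Icc _ _)
      (fun s _ => (h₁ s).continuousAt.continuousWithinAt)
      (fun s _ => (h₁ s).hasDerivWithinAt) (fun s _ => (h₂ s).hasDerivWithinAt)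
      fun s hs => sub_nonneg.2 (hc s (interior_subset hs))
  have := hconv.2 (show (-1 : ℝ) ∈ _ by simp) (show (1 : ℝ) ∈ _ by simp)
    (show (0 : ℝ) ≤ 1 / 2 by norm_num) (show (0 : ℝ) ≤ 1 / 2 by norm_num) (by norm_num)
  norm_num [← sub_eq_add_neg] at this
  linarith

theorem abs_difference_sub_le (hg : Differentiable ℝ g) {z v p : E} {η : ℝ}
    (hη : ∀ t ∈ Set.Icc (-1 : ℝ) 1, ‖gradient g (z + t • v) - p‖ ≤ η) :
    |g (z + v) - g (z - v) - 2 * ⟪p, v⟫| ≤ 2 * (η * ‖v‖) := by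
  have h₁ : ∀ s ∈ Set.Icc (-1 : ℝ) 1, HasDerivWithinAt (fun t : ℝ => g (z + t • v) - ⟪p, v⟫ * t)
      ⟪gradient g (z + s • v) - p, v⟫ (Set.Icc (-1) 1) s := fun s _ => by
    refine ((hg _).hasGradientAt.hasDerivAt_comp_add_smul.sub
      ((hasDerivAt_id s).const_mul ⟪p, v⟫)).hasDerivWithinAt.congr_deriv ?_
    simp [inner_sub_left]
  have := Convex.norm_image_sub_le_of_norm_hasDerivWithin_le (C := η * ‖v‖) h₁
    (fun s hs => (norm_inner_le_norm _ _).trans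
      (mul_le_mul_of_nonneg_right (hη s hs) (norm_nonneg v)))
    (convex_Icc _ _) (x := -1) (y := 1) (by simp) (by simp)
  norm_num [← sub_eq_add_neg] at this
  rw [mul_comm 2 (η * ‖v‖)]
  convert this using 2
  ring

variable [FiniteDimensional ℝ E]

/-- The infinitesimal form of the Prékopa–Leindler hypothesis, uniformly on a compact convex set. -/
theorem exists_forall_second_difference_le (hφ : ContDiff ℝ 2 φ)
    (hHess : ∀ x, HasFDerivAt (gradient φ) (Hess x) x)
    (hpos : ∀ x v, v ≠ 0 → 0 < ⟪v, Hess x v⟫) (hinv : ∀ x p, Hess x (Hinv x p) = p)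
    (hg : ContDiff ℝ 1 g) {B : Set E} (hB : IsCompact B) (hBc : Convex ℝ B) {ε : ℝ} (hε : 0 < ε) :
    ∃ δ₀ > 0, ∀ δ, 0 < δ → δ < δ₀ → ∀ z v, z + v ∈ B → z - v ∈ B →
      φ z - (φ (z + v) + φ (z - v)) / 2 - δ * (g (z + v) - g (z - v)) / 2 ≤
        δ ^ 2 / 2 * (⟪gradient g z, Hinv z (gradient g z)⟫ + ε) := by
  have hφ₁ : Differentiable ℝ φ := hφ.differentiable (by norm_num)
  have hg₁ : Differentiable ℝ g := hg.differentiable (by norm_num)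
  have hHc : Continuous Hess := continuous_hess hφ hHess
  have hgc : Continuous (gradient g) := (hg.gradient (k := 0) (by norm_num)).continuous
  have hnn : ∀ x v, 0 ≤ ⟪v, Hess x v⟫ := fun x v => by
    rcases eq_or_ne v 0 with rfl | hv
    · simp
    · exact (hpos x v hv).le
  obtain ⟨m, hm₀, hm⟩ : ∃ m : ℝ, 0 < m ∧ ∀ x ∈ B, ∀ v, m * ‖v‖ ^ 2 ≤ ⟪v, Hess x v⟫ := by
    obtain ⟨m, hm₀, hm⟩ := (hB.prod (isCompact_sphere (0 : E) 1)).exists_forall_le'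
      (f := fun q : E × E => ⟪q.2, Hess q.1 q.2⟫) (a := 0) (by fun_prop) (by
        rintro ⟨x, v⟩ ⟨-, hv⟩
        exact hpos x v (ne_zero_of_mem_unit_sphere ⟨v, hv⟩))
    refine ⟨m, hm₀, fun x hx v => ?_⟩
    rcases eq_or_ne v 0 with rfl | hv
    · simp
    have hv' : ‖v‖ ≠ 0 := norm_ne_zero_iff.2 hv
    have h := hm (x, ‖v‖⁻¹ • v) ⟨hx, by simp [norm_smul, hv']⟩
    simp only [map_smul, real_inner_smul_left, real_inner_smul_right] at h
    calc m * ‖v‖ ^ 2 ≤ (‖v‖⁻¹ * (‖v‖⁻¹ * ⟪v, Hess x v⟫)) * ‖v‖ ^ 2 := by gcongr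
      _ = _ := by field_simp
  obtain ⟨L, hL⟩ := hB.exists_bound_of_continuousOn hgc.continuousOn
  set C : ℝ := 6 * |L| / m with hC
  have hC₀ : 0 ≤ C := by positivity
  set η : ℝ := ε / (C ^ 2 + 2 * C + 1) with hη
  have hη₀ : 0 < η := by positivity
  have hηε : η * (C ^ 2 + 2 * C) ≤ ε := by
    have : η * (C ^ 2 + 2 * C + 1) = ε := by rw [hη]; field_simp
    nlinarith
  obtain ⟨ρ₁, hρ₁, hH⟩ := Metric.uniformContinuousOn_iff.1
    (hB.uniformContinuousOn_of_continuous hHc.continuousOn) η hη₀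
  obtain ⟨ρ₂, hρ₂, hG⟩ := Metric.uniformContinuousOn_iff.1
    (hB.uniformContinuousOn_of_continuous hgc.continuousOn) η hη₀
  refine ⟨min ρ₁ ρ₂ / (C + 1), by positivity, fun δ hδ₀ hδ z v hzv hzv' => ?_⟩
  have hseg : ∀ t ∈ Set.Icc (-1 : ℝ) 1, z + t • v ∈ B := fun t ht => by
    have := hBc hzv hzv' (a := (1 + t) / 2) (b := (1 - t) / 2) (by linarith [ht.1])
      (by linarith [ht.2]) (by ring)
    convert this using 1
    module
  have hz : z ∈ B := by simpa using hseg 0 (by simp)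
  have hQ : 0 ≤ ⟪gradient g z, Hinv z (gradient g z)⟫ := by
    have := hnn z (Hinv z (gradient g z))
    rwa [hinv, real_inner_comm] at this
  rcases le_total ‖v‖ (C * δ) with hv | hv
  · have hvρ : ‖v‖ < min ρ₁ ρ₂ := by
      have : δ * (C + 1) < min ρ₁ ρ₂ := (lt_div_iff₀ (by positivity)).1 hδ
      nlinarith
    have hdist : ∀ t ∈ Set.Icc (-1 : ℝ) 1, dist (z + t • v) z < min ρ₁ ρ₂ := fun t ht => by
      refine lt_of_le_of_lt ?_ hvρ
      simp only [dist_eq_norm, add_sub_cancel_left, norm_smul, Real.norm_eq_abs]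
      exact mul_le_of_le_one_left (norm_nonneg _) (abs_le.2 ht)
    have h₁ := le_second_difference hφ₁ hHess (z := z) (v := v)
      (c := ⟪v, Hess z v⟫ - η * ‖v‖ ^ 2) fun t ht => by
        have h := hH _ (hseg t ht) _ hz ((hdist t ht).trans_le (min_le_left _ _))
        rw [dist_eq_norm] at h
        have h' : |⟪v, (Hess (z + t • v) - Hess z) v⟫| ≤ ‖v‖ * (η * ‖v‖) :=
          (abs_real_inner_le_norm _ _).trans (mul_le_mul_of_nonneg_left
            (ContinuousLinearMap.le_of_opNorm_le _ h.le v) (norm_nonneg v))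
        rw [sub_apply, inner_sub_right] at h'
        linarith [(abs_le.1 h').1]
    have h₂ := abs_le.1 (abs_difference_sub_le hg₁ (z := z) (v := v)
      (p := gradient g z) (η := η) fun t ht => by
        have h := hG _ (hseg t ht) _ hz ((hdist t ht).trans_le (min_le_right _ _))
        rw [dist_eq_norm] at h
        exact h.le)
    have h₃ := neg_half_inner_sub_mul_inner_le (inner_hess_comm hφ₁ hHess z) (hnn z) (hinv z)
      (gradient g z) v δ
    have h₄ : δ * (2 * ⟪gradient g z, v⟫ - 2 * (η * ‖v‖)) ≤
        δ * (g (z + v) - g (z - v)) :=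
      mul_le_mul_of_nonneg_left (by linarith [h₂.1]) hδ₀.le
    have h₅ : η * ‖v‖ ^ 2 ≤ η * (C * δ) ^ 2 := by gcongr
    have h₆ : δ * (η * ‖v‖) ≤ δ * (η * (C * δ)) := by gcongr
    have h₇ : δ ^ 2 * (η * (C ^ 2 + 2 * C)) ≤ δ ^ 2 * ε := by gcongr
    linarith
  · have h₁ := le_second_difference hφ₁ hHess (z := z) (v := v)
      (c := m * ‖v‖ ^ 2) fun t ht => hm _ (hseg t ht) v
    have h₂ := abs_le.1 (abs_difference_sub_le hg₁ (z := z) (v := v)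
      (p := 0) (η := |L|) fun t ht => by
        simpa using (hL _ (hseg t ht)).trans (le_abs_self L))
    simp only [inner_zero_left, mul_zero, sub_zero] at h₂
    have h₄ : δ * (-(2 * (|L| * ‖v‖))) ≤ δ * (g (z + v) - g (z - v)) :=
      mul_le_mul_of_nonneg_left h₂.1 hδ₀.le
    have h₅ : m * (C * δ) * ‖v‖ ≤ m * ‖v‖ * ‖v‖ := by gcongr
    have h₆ : m * (C * δ) * ‖v‖ = 6 * (δ * (|L| * ‖v‖)) := by rw [hC]; field_simp
    have h₇ : 0 ≤ δ * (|L| * ‖v‖) := by positivity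
    have h₈ : 0 ≤ δ ^ 2 / 2 * (⟪gradient g z, Hinv z (gradient g z)⟫ + ε) := by
      positivity
    nlinarith

end Pointwise

section Expansion

/-- Second-order expansion at `δ = 0` of an exponential Prékopa–Leindler inequality. -/
theorem measureReal_mul_integral_sq_sub_le {α : Type*} [MeasurableSpace α] {ν : Measure α}
    [IsFiniteMeasure ν] {g q : α → ℝ} (hg : AEStronglyMeasurable g ν)
    (hq : AEStronglyMeasurable q ν) {M : ℝ} (hgM : ∀ᵐ x ∂ν, |g x| ≤ M)
    (hqM : ∀ᵐ x ∂ν, |q x| ≤ M) {δ₀ : ℝ} (hδ₀ : 0 < δ₀)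
    (H : ∀ δ, 0 < δ → δ < δ₀ → (∫ x, exp (-(δ * g x)) ∂ν) * ∫ x, exp (δ * g x) ∂ν ≤
      (∫ x, exp (δ ^ 2 / 2 * q x) ∂ν) ^ 2) :
    ν.real Set.univ * ∫ x, g x ^ 2 ∂ν - (∫ x, g x ∂ν) ^ 2 ≤ ν.real Set.univ * ∫ x, q x ∂ν := by
  have hgi : Integrable g ν := .of_bound hg M hgM
  have hqi : Integrable q ν := .of_bound hq M hqM
  have hg2i : Integrable (fun x => g x ^ 2) ν := .of_bound (hg.pow 2) (M ^ 2) <| by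
    filter_upwards [hgM] with x hx
    rw [Real.norm_eq_abs, abs_pow]
    gcongr
  have hexp : ∀ {u : α → ℝ}, AEStronglyMeasurable u ν → (∀ᵐ x ∂ν, |u x| ≤ 1) →
      Integrable (fun x => exp (u x)) ν := fun hu hu₁ =>
    .of_bound (Real.continuous_exp.comp_aestronglyMeasurable hu) (exp 1) <| by
      filter_upwards [hu₁] with x hx
      rw [Real.norm_eq_abs, Real.abs_exp]
      exact exp_le_exp.2 ((le_abs_self _).trans hx)
  set Z := ν.real Set.univ with hZ
  set a := ∫ x, g x ∂ν with ha
  set b := ∫ x, g x ^ 2 ∂ν with hb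
  set k := ∫ x, q x ∂ν with hk
  have lower : ∀ δ : ℝ, |δ| * M ≤ 1 →
      Z + δ * a + δ ^ 2 / 2 * b - |δ| ^ 3 * (M ^ 3 * Z) ≤ ∫ x, exp (δ * g x) ∂ν := by
    intro δ hδ
    have hδg : ∀ᵐ x ∂ν, |δ * g x| ≤ |δ| * M := by
      filter_upwards [hgM] with x hx
      rw [abs_mul]
      gcongr
    calc Z + δ * a + δ ^ 2 / 2 * b - |δ| ^ 3 * (M ^ 3 * Z)
        = ∫ x, (1 + δ * g x + δ ^ 2 / 2 * g x ^ 2 - |δ| ^ 3 * M ^ 3) ∂ν := by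
          rw [integral_sub (by fun_prop) (by fun_prop), integral_add (by fun_prop) (by fun_prop),
            integral_add (by fun_prop) (by fun_prop), integral_const_mul, integral_const_mul,
            integral_const, integral_const, ← ha, ← hb, ← hZ]
          simp only [smul_eq_mul]
          ring
      _ ≤ _ := by
          refine integral_mono_ae (by fun_prop)
            (hexp (hg.const_mul δ) (hδg.mono fun x hx => hx.trans hδ)) ?_
          filter_upwards [hδg] with x hx
          have h := (abs_le.1 (Real.exp_bound (hx.trans hδ) (n := 3) (by norm_num))).1
          have h₃ : |δ * g x| ^ 3 ≤ |δ| ^ 3 * M ^ 3 := by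
            rw [← mul_pow]
            gcongr
          have h₄ : 0 ≤ |δ * g x| ^ 3 := by positivity
          norm_num [Finset.sum_range_succ, Nat.factorial] at h
          rw [← abs_mul] at h
          nlinarith
  have upper : ∀ δ : ℝ, δ ^ 2 * M ≤ 1 →
      ∫ x, exp (δ ^ 2 / 2 * q x) ∂ν ≤ Z + δ ^ 2 / 2 * k + δ ^ 4 * (M ^ 2 * Z) := by
    intro δ hδ
    have hδq : ∀ᵐ x ∂ν, |δ ^ 2 / 2 * q x| ≤ δ ^ 2 * M := by
      filter_upwards [hqM] with x hx
      rw [abs_mul, abs_of_nonneg (by positivity : 0 ≤ δ ^ 2 / 2)]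
      gcongr
      linarith [sq_nonneg δ]
    calc ∫ x, exp (δ ^ 2 / 2 * q x) ∂ν
        ≤ ∫ x, (1 + δ ^ 2 / 2 * q x + δ ^ 4 * M ^ 2) ∂ν := by
          refine integral_mono_ae (hexp (hq.const_mul _) (hδq.mono fun x hx => hx.trans hδ))
            (by fun_prop) ?_
          filter_upwards [hδq] with x hx
          have h := (abs_le.1 (Real.abs_exp_sub_one_sub_id_le (hx.trans hδ))).2
          have h₃ : (δ ^ 2 / 2 * q x) ^ 2 ≤ (δ ^ 2 * M) ^ 2 :=
            sq_le_sq' (abs_le.1 hx).1 (abs_le.1 hx).2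
          nlinarith
      _ = _ := by
          rw [integral_add (by fun_prop) (by fun_prop), integral_add (by fun_prop) (by fun_prop),
            integral_const_mul, integral_const, integral_const, ← hk, ← hZ]
          simp only [smul_eq_mul]
          ring
  rcases (measureReal_nonneg (μ := ν) (s := Set.univ)).eq_or_lt with hZ₀ | hZ₀
  · rw [← hZ] at hZ₀
    rw [← hZ₀]
    nlinarith [sq_nonneg a]
  rw [← hZ] at hZ₀
  set c := M ^ 3 * Z
  set d := M ^ 2 * Z
  have hlim : Tendsto (fun δ : ℝ => (k / 2 + δ ^ 2 * d - b / 2 + c * δ) *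
      (2 * Z + δ ^ 2 * (k + b) / 2 + δ ^ 4 * d - c * δ ^ 3) + a ^ 2) (𝓝[>] 0)
      (𝓝 ((k - b) * Z + a ^ 2)) := by
    refine tendsto_nhdsWithin_of_tendsto_nhds ?_
    refine (Continuous.tendsto' (by fun_prop) _ _ ?_)
    ring
  have hsmall : ∀ {u : ℝ → ℝ} {r : ℝ}, Continuous u → u 0 < r → ∀ᶠ δ in 𝓝[>] 0, u δ < r :=
    fun hu h => nhdsWithin_le_nhds (hu.continuousAt.eventually_lt_const h)
  have hev : ∀ᶠ δ in 𝓝[>] (0 : ℝ), 0 ≤ (k / 2 + δ ^ 2 * d - b / 2 + c * δ) *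
      (2 * Z + δ ^ 2 * (k + b) / 2 + δ ^ 4 * d - c * δ ^ 3) + a ^ 2 := by
    filter_upwards [self_mem_nhdsWithin, hsmall continuous_id hδ₀,
      hsmall (u := fun δ => |δ| * M) (r := 1) (by fun_prop) (by simp),
      hsmall (u := fun δ => δ ^ 2 * M) (r := 1) (by fun_prop) (by simp),
      hsmall (u := fun δ => -(Z + δ * a + δ ^ 2 / 2 * b - δ ^ 3 * c)) (r := 0)
        (by fun_prop) (by simpa),
      hsmall (u := fun δ => -(Z - δ * a + δ ^ 2 / 2 * b - δ ^ 3 * c)) (r := 0)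
        (by fun_prop) (by simpa)] with δ hδ h₁ h₂ h₃ h₄ h₅
    have hδ : 0 < δ := hδ
    have l₁ := lower δ h₂.le
    have l₂ := lower (-δ) (by simpa using h₂.le)
    have u₁ := upper δ h₃.le
    rw [abs_neg] at l₂
    rw [abs_of_pos hδ] at l₁ l₂
    simp only [neg_mul, neg_sq, ← sub_eq_add_neg] at l₂
    have h₆ : (Z - δ * a + δ ^ 2 / 2 * b - δ ^ 3 * c) * (Z + δ * a + δ ^ 2 / 2 * b - δ ^ 3 * c) ≤
        (Z + δ ^ 2 / 2 * k + δ ^ 4 * d) ^ 2 :=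
      calc _ ≤ (∫ x, exp (-(δ * g x)) ∂ν) * ∫ x, exp (δ * g x) ∂ν := by
              refine mul_le_mul l₂ l₁ (by linarith) (by positivity)
        _ ≤ _ := H δ hδ h₁
        _ ≤ _ := by gcongr
    refine (mul_nonneg_iff_of_pos_left (pow_pos hδ 2)).1 ?_
    linarith
  have := ge_of_tendsto hlim hev
  linarith

end Expansion

section Local

variable {n : ℕ} {φ g : EuclideanSpace ℝ (Fin n) → ℝ} {μ : Measure (EuclideanSpace ℝ (Fin n))}

theorem setIntegral_exp_mul_setIntegral_exp_le [IsFiniteMeasure μ] (hφ : Continuous φ)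
    (hμ : μ = volume.withDensity fun x => ENNReal.ofReal (exp (-φ x)))
    {B : Set (EuclideanSpace ℝ (Fin n))} (hB : IsCompact B) (hBc : Convex ℝ B)
    {u v w : EuclideanSpace ℝ (Fin n) → ℝ} (hu : Continuous u) (hv : Continuous v)
    (hw : Continuous w)
    (H : ∀ z d, z + d ∈ B → z - d ∈ B →
      φ z - (φ (z + d) + φ (z - d)) / 2 + (u (z + d) + v (z - d)) / 2 ≤ w z) :
    (∫ x in B, exp (u x) ∂μ) * ∫ x in B, exp (v x) ∂μ ≤ (∫ x in B, exp (w x) ∂μ) ^ 2 := by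
  have conv : ∀ {u : EuclideanSpace ℝ (Fin n) → ℝ}, Continuous u →
      ∫⁻ x in B, ENNReal.ofReal (exp (u x)) ∂μ =
        ∫⁻ x, B.indicator (fun x => ENNReal.ofReal (exp (u x - φ x))) x := by
    intro u hu
    rw [lintegral_indicator hB.measurableSet, hμ, restrict_withDensity hB.measurableSet,
      lintegral_withDensity_eq_lintegral_mul _ (by fun_prop) (by fun_prop)]
    refine lintegral_congr fun x => ?_
    rw [Pi.mul_apply, ← ENNReal.ofReal_mul (exp_pos _).le, ← Real.exp_add]
    ring_nf
  have meas : ∀ {u : EuclideanSpace ℝ (Fin n) → ℝ}, Continuous u →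
      Measurable (B.indicator fun x => ENNReal.ofReal (exp (u x - φ x))) := fun hu =>
    Measurable.indicator (by fun_prop) hB.measurableSet
  have toInt : ∀ {u : EuclideanSpace ℝ (Fin n) → ℝ}, Continuous u →
      ENNReal.ofReal (∫ x in B, exp (u x) ∂μ) = ∫⁻ x in B, ENNReal.ofReal (exp (u x)) ∂μ :=
    fun hu => ofReal_integral_eq_lintegral_ofReal
      ((by fun_prop : Continuous _).continuousOn.integrableOn_compact hB)
      (ae_of_all _ fun x => (exp_pos _).le)
  rw [← ENNReal.ofReal_le_ofReal_iff (by positivity), ENNReal.ofReal_mul (by positivity),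
    ENNReal.ofReal_pow (by positivity), toInt hu, toInt hv, toInt hw, conv hu, conv hv, conv hw]
  refine prekopaLeindler_euclideanSpace n _ _ _ (meas hu) (meas hv) (meas hw) fun x y => ?_
  by_cases hx : x ∈ B
  swap
  · simp [hx]
  by_cases hy : y ∈ B
  swap
  · simp [hy]
  have hxz : midpoint ℝ x y + (1 / 2 : ℝ) • (x - y) = x := by
    rw [midpoint_eq_smul_add, invOf_eq_inv]
    module
  have hyz : midpoint ℝ x y - (1 / 2 : ℝ) • (x - y) = y := by
    rw [midpoint_eq_smul_add, invOf_eq_inv]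
    module
  have h := H (midpoint ℝ x y) ((1 / 2 : ℝ) • (x - y)) (by rwa [hxz]) (by rwa [hyz])
  rw [hxz, hyz] at h
  rw [Set.indicator_of_mem hx, Set.indicator_of_mem hy,
    Set.indicator_of_mem (hBc.midpoint_mem hx hy), ← ENNReal.ofReal_mul (exp_pos _).le,
    ← ENNReal.ofReal_pow (exp_pos _).le, ← Real.exp_add, pow_two, ← Real.exp_add]
  refine ENNReal.ofReal_le_ofReal (exp_le_exp.2 ?_)
  linarith

/-- The Brascamp–Lieb inequality on a compact convex set, with an additive error. -/
theorem measureReal_mul_setIntegral_sq_sub_le [IsFiniteMeasure μ]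
    {Hess Hinv : EuclideanSpace ℝ (Fin n) →
      EuclideanSpace ℝ (Fin n) →L[ℝ] EuclideanSpace ℝ (Fin n)} (hφ : ContDiff ℝ 2 φ)
    (hHess : ∀ x, HasFDerivAt (gradient φ) (Hess x) x)
    (hpos : ∀ x v, v ≠ 0 → 0 < ⟪v, Hess x v⟫)
    (hinv : ∀ x, (Hess x).comp (Hinv x) = ContinuousLinearMap.id ℝ _ ∧
      (Hinv x).comp (Hess x) = ContinuousLinearMap.id ℝ _)
    (hμ : μ = volume.withDensity fun x => ENNReal.ofReal (exp (-φ x))) (hg : ContDiff ℝ 1 g)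
    {B : Set (EuclideanSpace ℝ (Fin n))} (hB : IsCompact B) (hBc : Convex ℝ B)
    {ε : ℝ} (hε : 0 < ε) :
    μ.real B * ∫ x in B, g x ^ 2 ∂μ - (∫ x in B, g x ∂μ) ^ 2 ≤
      μ.real B * ∫ x in B, (⟪gradient g x, Hinv x (gradient g x)⟫ + ε) ∂μ := by
  have hgc : Continuous (gradient g) := (hg.gradient (k := 0) (by norm_num)).continuous
  have hJc : Continuous Hinv := continuous_hinv (continuous_hess hφ hHess) hinv
  have hqc : Continuous fun x => ⟪gradient g x, Hinv x (gradient g x)⟫ + ε := by fun_prop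
  obtain ⟨M₁, hM₁⟩ := hB.exists_bound_of_continuousOn hg.continuous.continuousOn
  obtain ⟨M₂, hM₂⟩ := hB.exists_bound_of_continuousOn hqc.continuousOn
  obtain ⟨δ₀, hδ₀, hδ⟩ := exists_forall_second_difference_le hφ hHess hpos
    (fun x p => DFunLike.congr_fun (hinv x).1 p) hg hB hBc hε
  rw [← measureReal_restrict_apply_univ]
  refine measureReal_mul_integral_sq_sub_le (M := max M₁ M₂)
    hg.continuous.aestronglyMeasurable hqc.aestronglyMeasurable
    ((ae_restrict_iff' hB.measurableSet).2 <| ae_of_all _ fun x hx =>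
      (hM₁ x hx).trans (le_max_left _ _))
    ((ae_restrict_iff' hB.measurableSet).2 <| ae_of_all _ fun x hx =>
      (hM₂ x hx).trans (le_max_right _ _)) hδ₀ fun δ hδ₁ hδ₂ => ?_
  have := hg.continuous
  refine setIntegral_exp_mul_setIntegral_exp_le hφ.continuous hμ hB hBc (by fun_prop)
    (by fun_prop) (by fun_prop) fun z d h₁ h₂ => ?_
  have h := hδ δ hδ₁ hδ₂ z d h₁ h₂
  linarith

end Local

theorem brascamp_lieb (n : ℕ) (φ : EuclideanSpace ℝ (Fin n) → ℝ)
    (hφ : ContDiff ℝ 2 φ) (hconv : StrictConvexOn ℝ Set.univ φ)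
    (Hess : EuclideanSpace ℝ (Fin n) →
      EuclideanSpace ℝ (Fin n) →L[ℝ] EuclideanSpace ℝ (Fin n))
    (hHess : ∀ x, HasFDerivAt (gradient φ) (Hess x) x)
    (hpos : ∀ x v, v ≠ 0 → 0 < ⟪v, Hess x v⟫)
    (Hinv : EuclideanSpace ℝ (Fin n) →
      EuclideanSpace ℝ (Fin n) →L[ℝ] EuclideanSpace ℝ (Fin n))
    (hinv : ∀ x, (Hess x).comp (Hinv x) = ContinuousLinearMap.id ℝ _ ∧
      (Hinv x).comp (Hess x) = ContinuousLinearMap.id ℝ _)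
    (hcoer : Tendsto (fun x => φ x / ‖x‖) (cobounded (EuclideanSpace ℝ (Fin n))) atTop)
    (hnorm : ∫ x, Real.exp (-φ x) = 1)
    (μ : Measure (EuclideanSpace ℝ (Fin n)))
    (hμ : μ = volume.withDensity fun x => ENNReal.ofReal (Real.exp (-φ x)))
    (g : EuclideanSpace ℝ (Fin n) → ℝ) (hg : ContDiff ℝ 1 g)
    (hgi : Integrable g μ)
    (hgi2 : Integrable (fun x => (g x - ∫ y, g y ∂μ) ^ 2) μ)
    (hgi3 : Integrable (fun x => ⟪gradient g x, Hinv x (gradient g x)⟫) μ) :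
    Var μ g ≤ ∫ x, ⟪gradient g x, Hinv x (gradient g x)⟫ ∂μ := by
  have hint : Integrable fun x => exp (-φ x) := .of_integral_ne_zero (by simp [hnorm])
  have hprob : IsProbabilityMeasure μ := ⟨by
    rw [hμ, withDensity_apply _ MeasurableSet.univ, Measure.restrict_univ,
      ← ofReal_integral_eq_lintegral_ofReal hint (ae_of_all _ fun x => (exp_pos _).le), hnorm,
      ENNReal.ofReal_one]⟩
  set m := ∫ y, g y ∂μ with hm
  have hgrad : ∀ x, gradient (fun y => g y - m) x = gradient g x := fun x => by
    simp [gradient, fderiv_sub_const]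
  let B : ℕ → Set (EuclideanSpace ℝ (Fin n)) := fun N => Metric.closedBall 0 N
  have hBU : ⋃ N, B N = Set.univ := Metric.iUnion_closedBall_nat 0
  have hlim : ∀ {f : EuclideanSpace ℝ (Fin n) → ℝ}, Integrable f μ →
      Tendsto (fun N => ∫ x in B N, f x ∂μ) atTop (𝓝 (∫ x, f x ∂μ)) := fun {f} hf => by
    have := tendsto_setIntegral_of_monotone (s := B)
      (fun N => Metric.isClosed_closedBall.measurableSet)
      (fun N M hNM => Metric.closedBall_subset_closedBall (by exact_mod_cast hNM))
      (hf.integrableOn (s := ⋃ N, B N))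
    rwa [hBU, Measure.restrict_univ] at this
  have hZ : Tendsto (fun N => μ.real (B N)) atTop (𝓝 1) := by
    simpa using hlim (integrable_const (1 : ℝ))
  have key : ∀ N : ℕ, μ.real (B N) * ∫ x in B N, (g x - m) ^ 2 ∂μ -
      (∫ x in B N, (g x - m) ∂μ) ^ 2 ≤ μ.real (B N) *
        (∫ x in B N, ⟪gradient g x, Hinv x (gradient g x)⟫ ∂μ +
          μ.real (B N) * (1 / ((N : ℝ) + 1))) := fun N => by
    have h := measureReal_mul_setIntegral_sq_sub_le hφ hHess hpos hinv hμ
      (hg.sub (contDiff_const (c := m))) (isCompact_closedBall (0 : EuclideanSpace ℝ (Fin n)) N)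
      (convex_closedBall _ _) (Nat.one_div_pos_of_nat (α := ℝ) (n := N))
    simp only [hgrad] at h
    rwa [integral_add hgi3.integrableOn (integrable_const _), setIntegral_const,
      smul_eq_mul] at h
  have hmean : ∫ x, (g x - m) ∂μ = 0 := by
    rw [integral_sub hgi (integrable_const _)]
    simp [hm]
  have := le_of_tendsto_of_tendsto' ((hZ.mul (hlim hgi2)).sub
    ((hlim (hgi.sub (integrable_const m))).pow 2))
    (hZ.mul ((hlim hgi3).add (hZ.mul tendsto_one_div_add_atTop_nhds_zero_nat))) key
  simpa [Var, hmean, ← hm] using this
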